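/- For every positive integer n, the Ramsey parameter for ordered 4-matchings satisfies (1/4)·n^{1/15} ≤ L_4(n) ≤ ⌈n^{1/15}⌉. -/

import Mathlib

/-- An ordered `r`-matching of size `n`: a partition of `{1,…,r*n}` into `n`
edges, each of size `r`. -/
def IsOrderedMatching (r n : ℕ) (M : Finset (Finset ℕ)) : Prop :=
  M.card = n ∧ (∀ e ∈ M, e.card = r) ∧
    (∀ e ∈ M, ∀ f ∈ M, e ≠ f → Disjoint e f) ∧
    M.biUnion id = Finset.Icc 1 (r * n)

/-- Two edges `e, f` form the pattern `P`: there is a strictly increasing map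
on `e ∪ f` sending the pair `{e, f}` to the pair of edges of `P`. -/
def FormsPattern (e f : Finset ℕ) (P : Finset (Finset ℕ)) : Prop :=
  ∃ φ : ℕ → ℕ, StrictMonoOn φ (↑(e ∪ f) : Set ℕ) ∧
    ({e.image φ, f.image φ} : Finset (Finset ℕ)) = P

/-- An `r`-pattern: an ordered `r`-matching of size `2` (on `{1,…,2r}`). -/
def IsPattern (r : ℕ) (P : Finset (Finset ℕ)) : Prop :=
  IsOrderedMatching r 2 P

/-- A collection of edges in which every pair of distinct edges forms `P`. -/
def IsPatternClique (P S : Finset (Finset ℕ)) : Prop :=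
  ∀ e ∈ S, ∀ f ∈ S, e ≠ f → FormsPattern e f P

/-- `L_P(M)`: the maximum size of a sub-matching of `M` which is a `P`-clique. -/
noncomputable def cliqueSize (P M : Finset (Finset ℕ)) : ℕ :=
  sSup {k | ∃ S ⊆ M, IsPatternClique P S ∧ S.card = k}

/-- `L(M) = max_P L_P(M)`, the maximum over all `r`-patterns `P`. -/
noncomputable def Lmax (r : ℕ) (M : Finset (Finset ℕ)) : ℕ :=
  sSup {k | ∃ P, IsPattern r P ∧ cliqueSize P M = k}

section OrderedMatching

open Finset

/-! ### Ranks and patterns -/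

section Rank

variable {α : Type*} [LinearOrder α]

/-- The rank of `x` in the finite set `V`: the number of elements of `V` that are at most `x`. -/
def rankIn (V : Finset α) (x : α) : ℕ := #{y ∈ V | y ≤ x}

theorem strictMonoOn_rankIn (V : Finset α) : StrictMonoOn (rankIn V) V := by
  intro x _ y hy hxy
  refine card_lt_card (ssubset_iff_of_subset ?_ |>.2 ⟨y, ?_, ?_⟩)
  · exact fun z hz => by
      rw [mem_filter] at hz ⊢
      exact ⟨hz.1, hz.2.trans hxy.le⟩
  · exact mem_filter.2 ⟨hy, le_rfl⟩
  · exact fun h => (mem_filter.1 h).2.not_gt hxy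

theorem image_rankIn (V : Finset α) : V.image (rankIn V) = Icc 1 #V := by
  refine eq_of_subset_of_card_le ?_ ?_
  · intro k hk
    obtain ⟨x, hx, rfl⟩ := mem_image.1 hk
    exact mem_Icc.2 ⟨card_pos.2 ⟨x, mem_filter.2 ⟨hx, le_rfl⟩⟩, card_filter_le _ _⟩
  · rw [card_image_of_injOn (strictMonoOn_rankIn V).injOn]
    simp

/-- Replacing every vertex by its rank turns a finite family of pairwise disjoint `r`-sets in a
linear order into an ordered `r`-matching. -/
theorem isOrderedMatching_image_rankIn {r : ℕ} {E : Finset (Finset α)}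
    (hcard : ∀ e ∈ E, #e = r) (hdisj : ∀ e ∈ E, ∀ f ∈ E, e ≠ f → Disjoint e f) :
    IsOrderedMatching r #E (E.image fun e => e.image (rankIn (E.biUnion id))) := by
  have hsub : ∀ e ∈ E, e ⊆ E.biUnion id := fun e he => subset_biUnion_of_mem id he
  have hinj : Set.InjOn (rankIn (E.biUnion id)) (E.biUnion id : Finset α) :=
    (strictMonoOn_rankIn _).injOn
  have hV : #(E.biUnion id) = r * #E := by
    have h : #(E.biUnion id) = ∑ e ∈ E, #e :=
      card_biUnion fun e he f hf hef => hdisj e he f hf hef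
    rw [h, sum_const_nat hcard, mul_comm]
  refine ⟨card_image_of_injOn ?_, ?_, ?_, ?_⟩
  · intro e he f hf hef
    exact image_injOn_powerset_of_injOn hinj (mem_coe.2 (mem_powerset.2 (hsub e he)))
      (mem_coe.2 (mem_powerset.2 (hsub f hf))) hef
  · simp only [forall_mem_image]
    intro e he
    rw [card_image_of_injOn (hinj.mono (coe_subset.2 (hsub e he))), hcard e he]
  · simp only [forall_mem_image]
    intro e he f hf hef
    have hne : e ≠ f := fun h => hef (by rw [h])
    rw [disjoint_left]
    intro x hx hx'
    obtain ⟨a, ha, rfl⟩ := mem_image.1 hx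
    obtain ⟨b, hb, hab⟩ := mem_image.1 hx'
    have := hinj (hsub f hf hb) (hsub e he ha) hab
    exact disjoint_left.1 (hdisj e he f hf hne) ha (this ▸ hb)
  · rw [← hV, ← image_rankIn, biUnion_image, image_biUnion]
    rfl

theorem rankIn_image_union_image {n : ℕ} {v w : Fin n → α} (hv : Function.Injective v)
    (hw : Function.Injective w) (hvw : ∀ j k, v j ≠ w k) (x : α) :
    rankIn (univ.image v ∪ univ.image w) x = #{j | v j ≤ x} + #{j | w j ≤ x} := by
  have hd : Disjoint (univ.image v) (univ.image w) := by
    simp only [disjoint_left, mem_image, mem_univ, true_and]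
    rintro _ ⟨j, rfl⟩ ⟨k, hk⟩
    exact hvw j k hk.symm
  rw [rankIn, filter_union, card_union_of_disjoint (disjoint_filter_filter hd), filter_image,
    filter_image, card_image_of_injective _ hv, card_image_of_injective _ hw]

end Rank

section Pattern

theorem FormsPattern.symm {e f : Finset ℕ} {P : Finset (Finset ℕ)} (h : FormsPattern e f P) :
    FormsPattern f e P := by
  obtain ⟨φ, hφ, hP⟩ := h
  exact ⟨φ, by rwa [union_comm], by rwa [pair_comm]⟩

/-- Two pairs of edges with the same relative order of their vertices form the same pattern. -/
theorem exists_isPattern_of_lt_iff {r : ℕ} (hr : 0 < r) {v w : Fin r → ℕ} (hv : StrictMono v)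
    (hw : StrictMono w) (hvw : ∀ j k, v j ≠ w k) :
    ∃ P, IsPattern r P ∧ ∀ v' w' : Fin r → ℕ, StrictMono v' → StrictMono w' →
      (∀ j k, v' j ≠ w' k) → (∀ j k, v' j < w' k ↔ v j < w k) →
      FormsPattern (univ.image v') (univ.image w') P := by
  have hd : Disjoint (univ.image v) (univ.image w) := by
    simp only [disjoint_left, mem_image, mem_univ, true_and]
    rintro _ ⟨j, rfl⟩ ⟨k, hk⟩
    exact hvw j k hk.symm
  have hne : univ.image v ≠ univ.image w := by
    intro h
    rw [← h, disjoint_self_iff_empty, image_eq_empty] at hd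
    exact (univ_nonempty_iff.2 ⟨⟨0, hr⟩⟩).ne_empty hd
  refine ⟨{(univ.image v).image (rankIn (univ.image v ∪ univ.image w)),
      (univ.image w).image (rankIn (univ.image v ∪ univ.image w))}, ?_,
    fun v' w' hv' hw' hvw' hlt =>
      ⟨rankIn (univ.image v' ∪ univ.image w'), strictMonoOn_rankIn _, ?_⟩⟩
  · have h := isOrderedMatching_image_rankIn (r := r) (E := {univ.image v, univ.image w})
      (by simp [card_image_of_injective _ hv.injective, card_image_of_injective _ hw.injective])
      (by
        simp only [mem_insert, mem_singleton]
        rintro e (rfl | rfl) f (rfl | rfl) hef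
        exacts [absurd rfl hef, hd, hd.symm, absurd rfl hef])
    rw [card_pair hne] at h
    simpa [IsPattern, image_insert, biUnion_insert] using h
  · have hge : ∀ j k, w' k ≤ v' j ↔ w k ≤ v j := fun j k => by
      rw [← not_lt, ← not_lt, hlt]
    have hle : ∀ j k, v' j ≤ w' k ↔ v j ≤ w k := fun j k => by
      rw [(hvw' j k).le_iff_lt, (hvw j k).le_iff_lt, hlt]
    congr 1
    · rw [image_image, image_image]
      refine image_congr fun k _ => ?_
      simp only [Function.comp, rankIn_image_union_image hv.injective hw.injective hvw,
        rankIn_image_union_image hv'.injective hw'.injective hvw', hv.le_iff_le, hv'.le_iff_le, hge]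
    · congr 1
      rw [image_image, image_image]
      refine image_congr fun k _ => ?_
      simp only [Function.comp, rankIn_image_union_image hv.injective hw.injective hvw,
        rankIn_image_union_image hv'.injective hw'.injective hvw', hw.le_iff_le, hw'.le_iff_le, hle]

theorem lt_iff_of_image_eq {r : ℕ} {v w v' w' : Fin r → ℕ} (hv : StrictMono v)
    (hw : StrictMono w) (hv' : StrictMono v') (hw' : StrictMono w') {φ φ' : ℕ → ℕ}
    (hφ : StrictMonoOn φ (↑(univ.image v ∪ univ.image w) : Set ℕ))
    (hφ' : StrictMonoOn φ' (↑(univ.image v' ∪ univ.image w') : Set ℕ))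
    (h₁ : (univ.image v).image φ = (univ.image v').image φ')
    (h₂ : (univ.image w).image φ = (univ.image w').image φ') (j k : Fin r) :
    v j < w k ↔ v' j < w' k := by
  have hmono : ∀ {u : Fin r → ℕ} {ψ : ℕ → ℕ} {s : Set ℕ}, StrictMono u → StrictMonoOn ψ s →
      (∀ j, u j ∈ s) → StrictMono (ψ ∘ u) :=
    fun hu hψ hs i j hij => hψ (hs i) (hs j) (hu hij)
  have hkey : ∀ {u u' : Fin r → ℕ}, StrictMono (φ ∘ u) → StrictMono (φ' ∘ u') →
      (univ.image u).image φ = (univ.image u').image φ' → φ ∘ u = φ' ∘ u' := by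
    intro u u' hu hu' h
    refine (StrictMono.range_inj hu hu').1 ?_
    rw [image_image, image_image] at h
    simpa [Function.comp_def] using congrArg (fun s : Finset ℕ => (s : Set ℕ)) h
  have mv : ∀ j, v j ∈ (↑(univ.image v ∪ univ.image w) : Set ℕ) := by simp
  have mw : ∀ j, w j ∈ (↑(univ.image v ∪ univ.image w) : Set ℕ) := by simp
  have mv' : ∀ j, v' j ∈ (↑(univ.image v' ∪ univ.image w') : Set ℕ) := by simp
  have mw' : ∀ j, w' j ∈ (↑(univ.image v' ∪ univ.image w') : Set ℕ) := by simp
  have e₁ := congrFun (hkey (hmono hv hφ mv) (hmono hv' hφ' mv') h₁) j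
  have e₂ := congrFun (hkey (hmono hw hφ mw) (hmono hw' hφ' mw') h₂) k
  simp only [Function.comp] at e₁ e₂
  rw [← hφ.lt_iff_lt (mv j) (mw k), ← hφ'.lt_iff_lt (mv' j) (mw' k), e₁, e₂]

/-- Two pairs of edges forming the same pattern have, up to exchanging the edges of one of the
pairs, the same relative order of their vertices. -/
theorem FormsPattern.lt_iff {r : ℕ} {v w v' w' : Fin r → ℕ} (hv : StrictMono v)
    (hw : StrictMono w) (hv' : StrictMono v') (hw' : StrictMono w') {P : Finset (Finset ℕ)}
    (h : FormsPattern (univ.image v) (univ.image w) P)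
    (h' : FormsPattern (univ.image v') (univ.image w') P) :
    (∀ j k, v j < w k ↔ v' j < w' k) ∨ (∀ j k, w j < v k ↔ v' j < w' k) := by
  obtain ⟨φ, hφ, hP⟩ := h
  obtain ⟨φ', hφ', hP'⟩ := h'
  rw [← hP'] at hP
  have hP₂ := congrArg (fun s : Finset (Finset ℕ) => (s : Set (Finset ℕ))) hP
  simp only [coe_insert, coe_singleton, Set.pair_eq_pair_iff] at hP₂
  rcases hP₂ with ⟨h₁, h₂⟩ | ⟨h₁, h₂⟩
  · exact Or.inl (lt_iff_of_image_eq hv hw hv' hw' hφ hφ' h₁ h₂)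
  · rw [union_comm] at hφ
    exact Or.inr (lt_iff_of_image_eq hw hv hv' hw' hφ hφ' h₂ h₁)

theorem Lmax_le {r m : ℕ} {M : Finset (Finset ℕ)}
    (h : ∀ P, ∀ S ⊆ M, IsPatternClique P S → #S ≤ m) : Lmax r M ≤ m := by
  refine csSup_le' ?_
  rintro _ ⟨P, -, rfl⟩
  refine csSup_le' ?_
  rintro _ ⟨S, hS, hc, rfl⟩
  exact h P S hS hc

theorem card_le_Lmax {r : ℕ} {M S P : Finset (Finset ℕ)} (hP : IsPattern r P) (hS : S ⊆ M)
    (hc : IsPatternClique P S) : #S ≤ Lmax r M := by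
  have hb : ∀ Q, #M ∈ upperBounds {k | ∃ S ⊆ M, IsPatternClique Q S ∧ #S = k} := by
    rintro Q _ ⟨S, hS, -, rfl⟩
    exact card_le_card hS
  refine (le_csSup ⟨_, hb P⟩ ⟨S, hS, hc, rfl⟩).trans (le_csSup ⟨#M, ?_⟩ ⟨P, hP, rfl⟩)
  rintro _ ⟨Q, -, rfl⟩
  exact csSup_le' (hb Q)

/-- A set of edges, with vertices enumerated by `v`, in which all pairs of distinct edges have the
same relative order of their vertices. -/
def IsHomogeneous {ι α : Type*} [LT α] {r : ℕ} (v : ι → Fin r → α) (A : Finset ι) : Prop :=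
  ∃ D : Fin r → Fin r → Prop, ∀ e ∈ A, ∀ f ∈ A, e ≠ f →
    (∀ j k, v e j < v f k ↔ D j k) ∨ (∀ j k, v f j < v e k ↔ D j k)

theorem IsPatternClique.isHomogeneous {ι : Type*} {r : ℕ} {P : Finset (Finset ℕ)} {A : Finset ι}
    {v : ι → Fin r → ℕ} (hv : ∀ e ∈ A, StrictMono (v e))
    (hinj : Set.InjOn (fun e => univ.image (v e)) (A : Set ι))
    (hA : IsPatternClique P (A.image fun e => univ.image (v e))) : IsHomogeneous v A := by
  have hform : ∀ e ∈ A, ∀ f ∈ A, e ≠ f → FormsPattern (univ.image (v e)) (univ.image (v f)) P :=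
    fun e he f hf hne => hA _ (mem_image_of_mem _ he) _ (mem_image_of_mem _ hf)
      fun h => hne (hinj he hf h)
  by_cases h : ∃ e₀ ∈ A, ∃ f₀ ∈ A, e₀ ≠ f₀
  · obtain ⟨e₀, he₀, f₀, hf₀, hne₀⟩ := h
    exact ⟨fun j k => v e₀ j < v f₀ k, fun e he f hf hne =>
      FormsPattern.lt_iff (hv e he) (hv f hf) (hv e₀ he₀) (hv f₀ hf₀) (hform e he f hf hne)
        (hform e₀ he₀ f₀ hf₀ hne₀)⟩
  · push Not at h
    exact ⟨fun _ _ => True, fun e he f hf hne => absurd (h e he f hf) hne⟩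

theorem exists_isPattern {r : ℕ} (hr : 0 < r) : ∃ P, IsPattern r P := by
  obtain ⟨P, hP, -⟩ := exists_isPattern_of_lt_iff hr (v := fun j => 2 * (j : ℕ))
    (w := fun j => 2 * (j : ℕ) + 1) (fun i j h => by simpa using h)
    (fun i j h => by simpa using h) (fun j k => by omega)
  exact ⟨P, hP⟩

theorem IsHomogeneous.exists_isPatternClique {r : ℕ} (hr : 0 < r) {A : Finset (Finset ℕ)}
    {v : Finset ℕ → Fin r → ℕ} (hv : ∀ e ∈ A, StrictMono (v e))
    (hva : ∀ e ∈ A, univ.image (v e) = e)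
    (hd : ∀ e ∈ A, ∀ f ∈ A, e ≠ f → ∀ j k, v e j ≠ v f k) (hA : IsHomogeneous v A) :
    ∃ P, IsPattern r P ∧ IsPatternClique P A := by
  obtain ⟨D, hD⟩ := hA
  by_cases h : ∃ e₀ ∈ A, ∃ f₀ ∈ A, e₀ ≠ f₀ ∧ ∀ j k, v e₀ j < v f₀ k ↔ D j k
  · obtain ⟨e₀, he₀, f₀, hf₀, hne₀, hD₀⟩ := h
    obtain ⟨P, hP, hform⟩ :=
      exists_isPattern_of_lt_iff hr (hv e₀ he₀) (hv f₀ hf₀) (hd e₀ he₀ f₀ hf₀ hne₀)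
    have key : ∀ e ∈ A, ∀ f ∈ A, e ≠ f → (∀ j k, v e j < v f k ↔ D j k) → FormsPattern e f P := by
      intro e he f hf hne hef
      have := hform (v e) (v f) (hv e he) (hv f hf) (hd e he f hf hne)
        fun j k => (hef j k).trans (hD₀ j k).symm
      rwa [hva e he, hva f hf] at this
    refine ⟨P, hP, fun e he f hf hne => ?_⟩
    rcases hD e he f hf hne with h | h
    · exact key e he f hf hne h
    · exact (key f hf e he hne.symm h).symm
  · obtain ⟨P, hP⟩ := exists_isPattern hr
    refine ⟨P, hP, fun e he f hf hne => absurd ?_ h⟩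
    rcases hD e he f hf hne with h' | h'
    · exact ⟨e, he, f, hf, hne, h'⟩
    · exact ⟨f, hf, e, he, hne.symm, h'⟩

end Pattern

/-! ### The lower bound -/

section LowerBound

/-- Mirsky's theorem: a strict partial order without chains of more than `m` elements has a strictly
monotone labelling with labels `1, …, m`. -/
theorem exists_label {ι : Type*} {m : ℕ} (S : Finset ι) (R : ι → ι → Prop)
    (htrans : ∀ a b c, R a b → R b c → R a c) (hirr : ∀ a, ¬ R a a)
    (hm : ∀ A ⊆ S, (∀ a ∈ A, ∀ b ∈ A, a ≠ b → R a b ∨ R b a) → #A ≤ m) :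
    ∃ l : ι → ℕ, (∀ a ∈ S, l a ∈ Icc 1 m) ∧ ∀ a ∈ S, ∀ b ∈ S, R a b → l a < l b := by
  classical
  let F : ι → Finset (Finset ι) := fun a => {A ∈ S.powerset | a ∈ A ∧
    (∀ x ∈ A, ∀ y ∈ A, x ≠ y → R x y ∨ R y x) ∧ ∀ x ∈ A, x ≠ a → R x a}
  have hF : ∀ {a A}, A ∈ F a ↔ A ⊆ S ∧ a ∈ A ∧
      (∀ x ∈ A, ∀ y ∈ A, x ≠ y → R x y ∨ R y x) ∧ ∀ x ∈ A, x ≠ a → R x a := by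
    simp [F]
  have hself : ∀ a ∈ S, {a} ∈ F a := fun a ha => hF.2 ⟨by simpa using ha, by simp, by simp, by simp⟩
  refine ⟨fun a => (F a).sup card, fun a ha => mem_Icc.2 ⟨?_, ?_⟩, fun a ha b hb hab => ?_⟩
  · exact le_sup (f := card) (hself a ha)
  · exact Finset.sup_le fun A hA => hm A (hF.1 hA).1 (hF.1 hA).2.2.1
  · obtain ⟨A, hA, hsup⟩ := exists_mem_eq_sup (F a) ⟨_, hself a ha⟩ card
    obtain ⟨hAS, haA, hch, htop⟩ := hF.1 hA
    have hlt : ∀ x ∈ A, R x b := fun x hx => by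
      by_cases hxa : x = a
      · rwa [hxa]
      · exact htrans _ _ _ (htop x hx hxa) hab
    have hbA : b ∉ A := fun h => hirr b (hlt b h)
    have hins : insert b A ∈ F b := by
      refine hF.2 ⟨insert_subset hb hAS, mem_insert_self _ _, ?_, ?_⟩
      · intro x hx y hy hxy
        rcases mem_insert.1 hx with rfl | hxA
        · exact Or.inr (hlt y ((mem_insert.1 hy).resolve_left hxy.symm))
        · rcases mem_insert.1 hy with rfl | hyA
          · exact Or.inl (hlt x hxA)
          · exact hch x hxA y hyA hxy
      · exact fun x hx hxb => hlt x ((mem_insert.1 hx).resolve_left hxb)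
    have hle := le_sup (f := card) hins
    rw [card_insert_of_notMem hbA] at hle
    simp only
    omega

variable {r : ℕ}

/-- The set `C` cuts the positions `0, …, r` into blocks of consecutive positions, a cut at `c`
separating positions `c` and `c + 1`; `block C k` is the index of the block containing `k`. -/
def block (C : Finset (Fin r)) (k : Fin (r + 1)) : ℕ := #{c ∈ C | c.castSucc < k}

theorem block_mono (C : Finset (Fin r)) : Monotone (block C) := fun _ _ h =>
  card_le_card (monotone_filter_right _ fun _ _ hc => lt_of_lt_of_le hc h)

theorem block_zero (C : Finset (Fin r)) : block C 0 = 0 := by simp [block]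

theorem block_le_card (C : Finset (Fin r)) (k : Fin (r + 1)) : block C k ≤ #C := card_filter_le _ _

theorem exists_mem_of_block_lt {C : Finset (Fin r)} {j k : Fin (r + 1)}
    (h : block C j < block C k) : ∃ c ∈ C, j ≤ c.castSucc ∧ c.succ ≤ k := by
  by_contra! hc
  refine h.not_ge (card_le_card fun c hck => ?_)
  rw [mem_filter] at hck ⊢
  refine ⟨hck.1, lt_of_not_ge fun hj => (hc c hck.1 hj).not_ge ?_⟩
  exact Fin.castSucc_lt_iff_succ_le.1 hck.2

theorem block_castSucc_lt_block_succ {C : Finset (Fin r)} {c : Fin r} (hc : c ∈ C) :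
    block C c.castSucc < block C c.succ := by
  refine card_lt_card (ssubset_iff_of_subset ?_ |>.2 ⟨c, ?_, ?_⟩)
  · exact monotone_filter_right _ fun _ _ h => h.trans Fin.castSucc_lt_succ
  · exact mem_filter.2 ⟨hc, Fin.castSucc_lt_succ⟩
  · simp

/-- A property of positions that is invariant under every step across a gap outside `C` is constant
on the blocks of `C`. -/
theorem iff_of_block_eq {C : Finset (Fin r)} {g : Fin (r + 1) → Prop}
    (hg : ∀ c ∉ C, (g c.castSucc ↔ g c.succ)) {j k : Fin (r + 1)} (h : block C j = block C k) :
    g j ↔ g k := by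
  have key : ∀ k j : Fin (r + 1), j ≤ k → block C j = block C k → (g j ↔ g k) := by
    intro k
    induction k using Fin.induction with
    | zero => intro j hj _; rw [Fin.le_zero_iff.1 hj]
    | succ c ih =>
      intro j hj hjk
      rcases hj.eq_or_lt with rfl | hlt
      · rfl
      · have hjc : j ≤ c.castSucc := Fin.le_castSucc_iff.2 hlt
        have h₁ := block_mono C hjc
        have h₂ := block_mono C (Fin.castSucc_lt_succ (i := c)).le
        have hc : c ∉ C := fun hc => by
          have := block_castSucc_lt_block_succ hc
          omega
        exact (ih j hjc (by omega)).trans (hg c hc)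
  rcases le_total j k with hjk | hjk
  · exact key k j hjk h
  · exact (key j k hjk h.symm).symm

variable {ι : Type*} {v : ι → Fin (r + 1) → ℕ} {C : Finset (Fin r)} {S : Finset ι} {m : ℕ}

/-- The edge `e` precedes `f` in every block of `C` with index outside `τ`, and `f` precedes `e` in
every block with index in `τ`. -/
def BlockLT (v : ι → Fin (r + 1) → ℕ) (C : Finset (Fin r)) (τ : Finset ℕ) (e f : ι) : Prop :=
  ∀ j k, block C j = block C k → if block C j ∈ τ then v f j < v e k else v e j < v f k

theorem BlockLT.trans {τ : Finset ℕ} {e f g : ι} (hef : BlockLT v C τ e f)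
    (hfg : BlockLT v C τ f g) : BlockLT v C τ e g := by
  intro j k hjk
  have h₁ := hef j k hjk
  have h₂ := hef k k rfl
  have h₃ := hfg k k rfl
  have h₄ := hfg j k hjk
  rw [← hjk] at h₂ h₃
  split_ifs at * <;> omega

theorem not_blockLT_self (τ : Finset ℕ) (e : ι) : ¬ BlockLT v C τ e e := by
  intro h
  have := h 0 0 rfl
  split_ifs at this <;> omega

/-- All edges of `S` can be cut simultaneously at every gap in `C`. -/
def IsCut (v : ι → Fin (r + 1) → ℕ) (C : Finset (Fin r)) (S : Finset ι) : Prop :=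
  ∀ e ∈ S, ∀ f ∈ S, ∀ c ∈ C, v e c.castSucc < v f c.succ

theorem IsCut.lt_of_block_lt (hC : IsCut v C S) (hv : ∀ e ∈ S, StrictMono (v e)) {e f : ι}
    (he : e ∈ S) (hf : f ∈ S) {j k : Fin (r + 1)} (h : block C j < block C k) : v e j < v f k := by
  obtain ⟨c, hc, hj, hk⟩ := exists_mem_of_block_lt h
  exact ((hv e he).monotone hj).trans_lt ((hC e he f hf c hc).trans_le ((hv f hf).monotone hk))

theorem IsCut.isHomogeneous (hC : IsCut v C S) (hv : ∀ e ∈ S, StrictMono (v e)) {τ : Finset ℕ}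
    {A : Finset ι} (hA : A ⊆ S) (hch : ∀ e ∈ A, ∀ f ∈ A, e ≠ f →
      BlockLT v C τ e f ∨ BlockLT v C τ f e) : IsHomogeneous v A := by
  have key : ∀ e ∈ S, ∀ f ∈ S, BlockLT v C τ e f → ∀ j k,
      v e j < v f k ↔ (block C j = block C k ∧ block C j ∉ τ) ∨ block C j < block C k := by
    intro e he f hf hef j k
    rcases lt_trichotomy (block C j) (block C k) with h | h | h
    · simp [h, hC.lt_of_block_lt hv he hf h]
    · have h₁ := hef j k h
      have h₂ := hef k j h.symm
      rw [← h] at h₂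
      by_cases hτ : block C j ∈ τ
      · rw [if_pos hτ] at h₂
        simp [← h, hτ, h₂.le]
      · rw [if_neg hτ] at h₁
        simp [← h, hτ, h₁]
    · simp [h.ne', h.not_gt, (hC.lt_of_block_lt hv hf he h).le]
  exact ⟨_, fun e he f hf hne => (hch e he f hf hne).imp (key e (hA he) f (hA hf))
    (key f (hA hf) e (hA he))⟩

/-- Two edges are comparable in one of `2 ^ #C` orders, or one has a vertex in an uncut gap of the
other. -/
theorem exists_blockLT_or_exists_mem_gap {e f : ι} (he : StrictMono (v e)) (hf : StrictMono (v f))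
    (hd : ∀ j k, v e j ≠ v f k) :
    (∃ τ ∈ (Icc 1 #C).powerset, BlockLT v C τ e f ∨ BlockLT v C τ f e) ∨
      ∃ c ∉ C, ∃ j, (v e c.castSucc ≤ v f j ∧ v f j < v e c.succ) ∨
        (v f c.castSucc ≤ v e j ∧ v e j < v f c.succ) := by
  classical
  wlog h0 : v e 0 < v f 0 generalizing e f
  · rcases this hf he (fun j k => (hd k j).symm) (lt_of_le_of_ne (not_lt.1 h0) (hd 0 0).symm) with
      ⟨τ, hτ, h⟩ | ⟨c, hc, j, h⟩
    · exact Or.inl ⟨τ, hτ, h.symm⟩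
    · exact Or.inr ⟨c, hc, j, h.symm⟩
  by_cases hcross : ∃ c ∉ C, ∃ j, (v e c.castSucc ≤ v f j ∧ v f j < v e c.succ) ∨
        (v f c.castSucc ≤ v e j ∧ v e j < v f c.succ)
  · exact Or.inr hcross
  push Not at hcross
  have hF : ∀ {j k j' k'}, block C j = block C j' → block C k = block C k' →
      (v e j < v f k ↔ v e j' < v f k') := by
    intro j k j' k' hj hk
    refine (iff_of_block_eq (g := fun j => v e j < v f k) ?_ hj).trans
      (iff_of_block_eq (g := fun k => v e j' < v f k) ?_ hk)
    · intro c hc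
      have h₁ := (hcross c hc k).1
      have h₂ := he (Fin.castSucc_lt_succ (i := c))
      have h₃ := hd c.succ k
      exact ⟨fun h => lt_of_le_of_ne (h₁ h.le) h₃, fun h => h₂.trans h⟩
    · intro c hc
      have h₁ := (hcross c hc j').2
      have h₂ := hf (Fin.castSucc_lt_succ (i := c))
      exact ⟨fun h => h.trans h₂, fun h => by
        by_contra h'
        exact (h₁ (not_lt.1 h')).not_gt h⟩
  refine Or.inl ⟨{i ∈ Icc 1 #C | ∃ k, block C k = i ∧ ¬ v e k < v f k},
    mem_powerset.2 (filter_subset _ _), Or.inl fun j k hjk => ?_⟩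
  split_ifs with hτ
  · obtain ⟨-, k₀, hk₀, hlt⟩ := mem_filter.1 hτ
    rw [hF (hk₀.trans hjk) hk₀] at hlt
    exact lt_of_le_of_ne (not_lt.1 hlt) (hd k j).symm
  · rcases Nat.eq_zero_or_pos (block C j) with hj | hj
    · rw [← block_zero C] at hj
      exact (hF hj (hjk.symm.trans hj)).2 h0
    · by_contra hlt
      refine hτ (mem_filter.2 ⟨mem_Icc.2 ⟨hj, block_le_card C j⟩, j, rfl, ?_⟩)
      rwa [hF rfl hjk]

/-- If every set of edges that can be cut along one more gap has at most `B` elements, then a family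
of pairwise crossing edges has at most `2r(r + 1)B` elements. -/
theorem card_le_of_forall_exists_mem_gap [DecidableEq ι] {B : ℕ} {T : Finset ι}
    (hB : ∀ c ∉ C, ∀ x, #{e ∈ T | v e c.castSucc ≤ x ∧ x < v e c.succ} ≤ B)
    (hT : ∀ e ∈ T, ∀ f ∈ T, ∃ c ∉ C, ∃ j, (v e c.castSucc ≤ v f j ∧ v f j < v e c.succ) ∨
        (v f c.castSucc ≤ v e j ∧ v e j < v f c.succ)) :
    #T ≤ 2 * r * (r + 1) * B := by
  rcases T.eq_empty_or_nonempty with rfl | hne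
  · simp
  let G : ι × Fin r × Fin (r + 1) → Finset ι := fun q =>
    {e ∈ T | q.2.1 ∉ C ∧ v e q.2.1.castSucc ≤ v q.1 q.2.2 ∧ v q.1 q.2.2 < v e q.2.1.succ}
  let Q : Finset (ι × Fin r × Fin (r + 1)) := T ×ˢ univ
  have hG : ∀ q, #(G q) ≤ B := fun q => by
    by_cases hq : q.2.1 ∈ C
    · simp [G, hq]
    · simpa [G, hq] using hB q.2.1 hq (v q.1 q.2.2)
  have hsub : T ×ˢ T ⊆ Q.biUnion (fun q => G q ×ˢ {q.1}) ∪ Q.biUnion (fun q => {q.1} ×ˢ G q) := by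
    rintro ⟨e, f⟩ hef
    obtain ⟨he, hf⟩ := mem_product.1 hef
    obtain ⟨c, hc, j, h | h⟩ := hT e he f hf
    · refine mem_union_left _ (mem_biUnion.2 ⟨(f, c, j), by simpa [Q] using hf, ?_⟩)
      simp [G, he, hc, h]
    · refine mem_union_right _ (mem_biUnion.2 ⟨(e, c, j), by simpa [Q] using he, ?_⟩)
      simp [G, hf, hc, h]
  have hQ : #Q = #T * (r * (r + 1)) := by simp [Q]
  have h₁ : #(Q.biUnion fun q => G q ×ˢ ({q.1} : Finset ι)) ≤ #Q * B :=
    card_biUnion_le_card_mul _ _ _ fun q _ => by simpa using hG q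
  have h₂ : #(Q.biUnion fun q => ({q.1} : Finset ι) ×ˢ G q) ≤ #Q * B :=
    card_biUnion_le_card_mul _ _ _ fun q _ => by simpa using hG q
  have h₃ := (card_le_card hsub).trans (card_union_le _ _)
  rw [card_product] at h₃
  rw [hQ] at h₁ h₂
  refine Nat.le_of_mul_le_mul_left ?_ (card_pos.2 hne)
  calc #T * #T ≤ #T * (r * (r + 1)) * B + #T * (r * (r + 1)) * B := by omega
    _ = #T * (2 * r * (r + 1) * B) := by ring

/-- If every family of pairwise crossing edges has at most `B` elements, then an Erdős–Szekeres type
labelling by chain lengths bounds the number of all edges. -/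
theorem IsCut.card_le_mul_pow (hC : IsCut v C S) (hv : ∀ e ∈ S, StrictMono (v e))
    (hd : ∀ e ∈ S, ∀ f ∈ S, e ≠ f → ∀ j k, v e j ≠ v f k)
    (hm : ∀ A ⊆ S, IsHomogeneous v A → #A ≤ m) {B : ℕ}
    (hB : ∀ T ⊆ S, (∀ e ∈ T, ∀ f ∈ T, e ≠ f → ∃ c ∉ C, ∃ j,
      (v e c.castSucc ≤ v f j ∧ v f j < v e c.succ) ∨
        (v f c.castSucc ≤ v e j ∧ v e j < v f c.succ)) → #T ≤ B) :
    #S ≤ B * m ^ 2 ^ #C := by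
  classical
  choose l hl hlt using fun τ : Finset ℕ => exists_label S (BlockLT v C τ)
    (fun _ _ _ => BlockLT.trans) (not_blockLT_self τ)
    fun A hA hch => hm A hA (hC.isHomogeneous hv hA hch)
  have h := card_le_mul_card_image_of_maps_to (s := S)
    (t := (Icc 1 #C).powerset.pi fun _ => Icc 1 m) (f := fun e τ _ => l τ e)
    (fun e he => mem_pi.2 fun τ _ => hl τ e he) B ?_
  · simpa using h
  · intro y _
    refine hB _ (filter_subset _ _) fun e he f hf hne => ?_
    obtain ⟨heS, hey⟩ := mem_filter.1 he
    obtain ⟨hfS, hfy⟩ := mem_filter.1 hf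
    refine (exists_blockLT_or_exists_mem_gap (hv e heS) (hv f hfS) (hd e heS f hfS hne)).resolve_left
      ?_
    rintro ⟨τ, hτ, h⟩
    have hef : l τ e = l τ f := congrFun (congrFun (hey.trans hfy.symm) τ) hτ
    rcases h with h | h
    · exact (hlt τ e heS f hfS h).ne hef
    · exact (hlt τ f hfS e heS h).ne' hef

theorem IsCut.card_le (d : ℕ) (hdr : #C + d = r) (hC : IsCut v C S)
    (hv : ∀ e ∈ S, StrictMono (v e)) (hd : ∀ e ∈ S, ∀ f ∈ S, e ≠ f → ∀ j k, v e j ≠ v f k)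
    (hm : ∀ A ⊆ S, IsHomogeneous v A → #A ≤ m) :
    #S ≤ (2 * r * (r + 1)) ^ d * m ^ (2 ^ #C * (2 ^ (d + 1) - 1)) := by
  classical
  induction d generalizing C S with
  | zero =>
    have hu : C = univ := (card_eq_iff_eq_univ C).1 (by simpa using hdr)
    have h := hC.card_le_mul_pow hv hd hm (B := 1) fun T _ hT => card_le_one.2 fun e he f hf => by
      by_contra hne
      obtain ⟨c, hc, -⟩ := hT e he f hf hne
      exact hc (hu ▸ mem_univ c)
    simpa using h
  | succ d ih =>
    obtain ⟨c₀, hc₀⟩ : ∃ c₀, c₀ ∉ C := by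
      by_contra! h
      have := (card_eq_iff_eq_univ C).2 (eq_univ_of_forall h)
      rw [Fintype.card_fin] at this
      omega
    have h := hC.card_le_mul_pow hv hd hm
      (B := 2 * r * (r + 1) *
        ((2 * r * (r + 1)) ^ d * m ^ (2 ^ (#C + 1) * (2 ^ (d + 1) - 1)))) ?_
    · refine h.trans_eq ?_
      have hexp : 2 ^ #C * (2 ^ (d + 1 + 1) - 1) = 2 ^ (#C + 1) * (2 ^ (d + 1) - 1) + 2 ^ #C := by
        have := Nat.one_le_two_pow (n := d + 1)
        zify [this, Nat.one_le_two_pow (n := d + 1 + 1)]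
        ring
      rw [hexp, pow_add m]
      ring
    · intro T hTS hT
      refine card_le_of_forall_exists_mem_gap (v := v) (C := C) ?_ ?_
      · intro c hc x
        have hsub : {e ∈ T | v e c.castSucc ≤ x ∧ x < v e c.succ} ⊆ S :=
          (filter_subset _ _).trans hTS
        rw [← card_insert_of_notMem hc]
        refine ih (by rw [card_insert_of_notMem hc]; omega) ?_ (fun e he => hv e (hsub he))
          (fun e he f hf => hd e (hsub he) f (hsub hf)) fun A hA => hm A (hA.trans hsub)
        intro e he f hf c' hc'
        rcases mem_insert.1 hc' with rfl | hc'
        · exact (mem_filter.1 he).2.1.trans_lt (mem_filter.1 hf).2.2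
        · exact hC e (hsub he) f (hsub hf) c' hc'
      · intro e he f hf
        by_cases hef : e = f
        · subst hef
          exact ⟨c₀, hc₀, c₀.castSucc, Or.inl ⟨le_rfl, hv e (hTS he) Fin.castSucc_lt_succ⟩⟩
        · exact hT e he f hf hef

/-- An ordered `(r + 1)`-matching is bounded in terms of its largest clique. -/
theorem card_le_Lmax_pow {n : ℕ} {M : Finset (Finset ℕ)} (hM : IsOrderedMatching (r + 1) n M) :
    n ≤ (2 * r * (r + 1)) ^ r * Lmax (r + 1) M ^ (2 ^ (r + 1) - 1) := by
  obtain ⟨hcard, hedge, hdisj, -⟩ := hM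
  have hex : ∀ e : Finset ℕ, ∃ u : Fin (r + 1) → ℕ, e ∈ M → StrictMono u ∧ univ.image u = e := by
    intro e
    by_cases he : e ∈ M
    · exact ⟨e.orderEmbOfFin (hedge e he), fun _ => ⟨(e.orderEmbOfFin _).strictMono, by
        rw [← coe_inj]; simp⟩⟩
    · exact ⟨0, fun h => absurd h he⟩
  choose v hv using hex
  have hmem : ∀ e ∈ M, ∀ j, v e j ∈ e := fun e he j =>
    (hv e he).2.subset (mem_image_of_mem (v e) (mem_univ j))
  have hd : ∀ e ∈ M, ∀ f ∈ M, e ≠ f → ∀ j k, v e j ≠ v f k := by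
    intro e he f hf hne j k hjk
    exact disjoint_left.1 (hdisj e he f hf hne) (hmem e he j) (hjk ▸ hmem f hf k)
  have hm : ∀ A ⊆ M, IsHomogeneous v A → #A ≤ Lmax (r + 1) M := by
    intro A hA hom
    obtain ⟨P, hP, hc⟩ := hom.exists_isPatternClique r.succ_pos (fun e he => (hv e (hA he)).1)
      (fun e he => (hv e (hA he)).2) fun e he f hf => hd e (hA he) f (hA hf)
    exact card_le_Lmax hP hA hc
  have h := IsCut.card_le (v := v) (C := ∅) (S := M) r (by simp) (by simp [IsCut])
    (fun e he => (hv e he).1) hd hm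
  simpa [hcard] using h

end LowerBound

/-! ### The upper bound -/

section UpperBound

/-- A family of edges with vertices in an arbitrary linear order can be turned into an ordered
matching. -/
theorem exists_isOrderedMatching_of_isHomogeneous {ι α : Type*} [LinearOrder α] {r m : ℕ}
    (hr : 0 < r) {u : ι → Fin r → α} (hu : ∀ x, StrictMono (u x))
    (hne : ∀ x y, x ≠ y → ∀ j k, u x j ≠ u y k) {X : Finset ι}
    (hX : ∀ A ⊆ X, IsHomogeneous u A → #A ≤ m) :
    ∃ M, IsOrderedMatching r #X M ∧ Lmax r M ≤ m := by
  let E : Finset (Finset α) := X.image fun x => univ.image (u x)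
  have hdisj : ∀ x y, x ≠ y → Disjoint (univ.image (u x)) (univ.image (u y)) := by
    intro x y hxy
    simp only [disjoint_left, mem_image, mem_univ, true_and]
    rintro _ ⟨j, rfl⟩ ⟨k, hk⟩
    exact hne x y hxy j k hk.symm
  have hE : #E = #X := by
    refine card_image_of_injective _ fun x y hxy => by_contra fun h => ?_
    obtain ⟨k, -, hk⟩ := mem_image.1 (hxy.subset (mem_image_of_mem _ (mem_univ ⟨0, hr⟩)))
    exact hne y x (Ne.symm h) k _ hk
  have hM := isOrderedMatching_image_rankIn (r := r) (E := E)
    (by simp [E, card_image_of_injective _ (hu _).injective]) (by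
      simp only [E, forall_mem_image]
      exact fun x _ y _ h => hdisj x y fun h' => h (by rw [h']))
  have hρ := strictMonoOn_rankIn (E.biUnion id)
  generalize rankIn (E.biUnion id) = ρ at hρ hM
  rw [hE] at hM
  refine ⟨_, hM, Lmax_le fun P S hS hc => ?_⟩
  rw [image_image] at hS
  obtain ⟨A, hA, rfl⟩ := subset_image_iff.1 hS
  have hmem : ∀ x ∈ A, ∀ k, u x k ∈ (E.biUnion id : Set α) := fun x hx k =>
    mem_coe.2 (mem_biUnion.2 ⟨_, mem_image_of_mem _ (hA hx), mem_image_of_mem _ (mem_univ k)⟩)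
  have himage : ∀ x, (univ.image (u x)).image ρ = univ.image fun k => ρ (u x k) :=
    fun x => image_image
  obtain ⟨D, hD⟩ := IsPatternClique.isHomogeneous (P := P) (A := A) (v := fun x k => ρ (u x k))
    (fun x hx j k hjk => hρ (hmem x hx j) (hmem x hx k) (hu x hjk))
    (fun x hx y hy hxy => by
      by_contra h
      obtain ⟨k, -, hk⟩ := mem_image.1 (hxy.subset (mem_image_of_mem _ (mem_univ ⟨0, hr⟩)))
      exact hne y x (Ne.symm h) k _ (hρ.injOn (hmem y hy k) (hmem x hx _) hk))
    (by rwa [← funext himage])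
  exact card_image_le.trans (hX A hA ⟨D, fun x hx y hy h => (hD x hx y hy h).imp
    (fun h j k => (hρ.lt_iff_lt (hmem x hx j) (hmem y hy k)).symm.trans (h j k))
    (fun h j k => (hρ.lt_iff_lt (hmem y hy j) (hmem x hx k)).symm.trans (h j k))⟩)

/-- The coordinates `i = 0, …, 14` are grouped into stages of sizes `1, 2, 4, 8`. -/
def stage (i : Fin 15) : ℕ := Nat.log2 (i + 1)

/-- At each coordinate, the position `k` of a vertex lies in a track: at stage `s` the positions
`s, s + 1, …` share a track. -/
def track (i : Fin 15) (k : Fin 4) : ℕ := min k (stage i)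

/-- Whether the track `t` is increasing at the coordinate `i`. Track `0` always is, and the
coordinates of one stage realize all possibilities for the other tracks. -/
def orientation (i : Fin 15) (t : ℕ) : Bool := t == 0 || Nat.testBit (i + 1) (t - 1)

/-- The relative order of the vertices of two edges that first differ at the coordinate `i`;
the boolean `p` tells which of the edges is smaller there. -/
def vertexCmp (i : Fin 15) (p : Bool) (j k : Fin 4) : Bool :=
  if track i j = track i k then orientation i (track i j) == p else decide (j < k)

theorem stage_mono : Monotone stage := by decide

theorem eq_of_vertexCmp_eq : ∀ i i' : Fin 15, ∀ p p' : Bool,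
    (∀ j k, vertexCmp i p j k = vertexCmp i' p' j k) → i = i' := by
  decide +kernel

theorem track_mono (i : Fin 15) {j k : Fin 4} (h : j ≤ k) : track i j ≤ track i k :=
  min_le_min_right _ (by exact_mod_cast h)

theorem track_eq_of_le {i i' : Fin 15} (h : i' ≤ i) {j k : Fin 4} (hjk : track i j = track i k) :
    track i' j = track i' k := by
  have := stage_mono h
  simp only [track] at *
  omega

theorem vertexCmp_not_swap : ∀ i p j k, vertexCmp i (!p) k j = !vertexCmp i p j k := by
  decide +kernel

variable {m : ℕ}

theorem vertexCmp_swap (i : Fin 15) {a b : Fin m} (h : a ≠ b) (j k : Fin 4) :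
    vertexCmp i (decide (b < a)) k j = !vertexCmp i (decide (a < b)) j k := by
  have hp : decide (b < a) = !decide (a < b) := by
    rcases h.lt_or_gt with h | h <;> simp [h, h.le]
  rw [hp, vertexCmp_not_swap]

/-- The `i`-th coordinate of the position of the `k`-th vertex of the edge `x`. -/
def vertexCoord (x : Fin 15 → Fin m) (k : Fin 4) (i : Fin 15) : ℕ :=
  track i k * m + if orientation i (track i k) then (x i : ℕ) else m - 1 - x i

/-- The position of the `k`-th vertex of the edge `x`, in the lexicographic order. -/
def vertexKey (x : Fin 15 → Fin m) (k : Fin 4) : Lex (Fin 15 → ℕ) := toLex (vertexCoord x k)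

theorem vertexKey_lt_vertexKey {x y : Fin 15 → Fin m} {j k : Fin 4} (i : Fin 15)
    (h : ∀ i' < i, vertexCoord x j i' = vertexCoord y k i')
    (hi : vertexCoord x j i < vertexCoord y k i) : vertexKey x j < vertexKey y k :=
  ⟨i, h, hi⟩

theorem vertexCoord_eq {x y : Fin 15 → Fin m} {j k : Fin 4} {i : Fin 15} (hx : x i = y i)
    (ht : track i j = track i k) : vertexCoord x j i = vertexCoord y k i := by
  rw [vertexCoord, vertexCoord, hx, ht]

theorem vertexKey_lt_of_track_ne {x y : Fin 15 → Fin m} {i : Fin 15} (hxy : ∀ i' < i, x i' = y i')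
    {j k : Fin 4} (hjk : j < k) (hi : track i j ≠ track i k) : vertexKey x j < vertexKey y k := by
  obtain ⟨i₀, hi₀, hmin⟩ : ∃ i₀, track i₀ j ≠ track i₀ k ∧ ∀ i' < i₀, track i' j = track i' k := by
    obtain ⟨i₀, h₁, h₂⟩ := wellFounded_lt.has_min {i | track i j ≠ track i k} ⟨i, hi⟩
    exact ⟨i₀, h₁, fun i' hi' => by_contra fun h => h₂ i' h hi'⟩
  have hle : i₀ ≤ i := le_of_not_gt fun h => hi (hmin i h)
  refine vertexKey_lt_vertexKey i₀
    (fun i' hi' => vertexCoord_eq (hxy i' (hi'.trans_le hle)) (hmin i' hi')) ?_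
  have hlt : track i₀ j + 1 ≤ track i₀ k := lt_of_le_of_ne (track_mono i₀ hjk.le) hi₀
  have hm := Nat.mul_le_mul_right m hlt
  have hx := (x i₀).isLt
  rw [add_mul, one_mul] at hm
  simp only [vertexCoord]
  split_ifs <;> omega

theorem vertexKey_lt_of_vertexCmp {x y : Fin 15 → Fin m} {i : Fin 15} (hxy : ∀ i' < i, x i' = y i')
    (hi : x i ≠ y i) {j k : Fin 4} (h : vertexCmp i (decide (x i < y i)) j k) :
    vertexKey x j < vertexKey y k := by
  rw [vertexCmp] at h
  split_ifs at h with ht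
  · refine vertexKey_lt_vertexKey i
      (fun i' hi' => vertexCoord_eq (hxy i' hi') (track_eq_of_le hi'.le ht)) ?_
    have hx := (x i).isLt
    have hy := (y i).isLt
    have hne := Fin.val_ne_of_ne hi
    rw [beq_iff_eq] at h
    simp only [vertexCoord, ← ht, h, decide_eq_true_eq, Fin.lt_def]
    split_ifs <;> omega
  · exact vertexKey_lt_of_track_ne hxy (of_decide_eq_true h) ht

theorem vertexKey_lt_iff {x y : Fin 15 → Fin m} {i : Fin 15} (hxy : ∀ i' < i, x i' = y i')
    (hi : x i ≠ y i) (j k : Fin 4) :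
    vertexKey x j < vertexKey y k ↔ vertexCmp i (decide (x i < y i)) j k := by
  refine ⟨fun hlt => ?_, vertexKey_lt_of_vertexCmp hxy hi⟩
  by_contra h
  refine hlt.not_gt (vertexKey_lt_of_vertexCmp (fun i' hi' => (hxy i' hi').symm) hi.symm ?_)
  simpa [vertexCmp_swap i hi] using h

theorem vertexKey_strictMono (x : Fin 15 → Fin m) : StrictMono (vertexKey x) := fun j k hjk =>
  vertexKey_lt_of_track_ne (i := Fin.last 14) (fun _ _ => rfl) hjk (by revert j k; decide)

theorem exists_first_ne {x y : Fin 15 → Fin m} (h : x ≠ y) :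
    ∃ i, (∀ i' < i, x i' = y i') ∧ x i ≠ y i := by
  obtain ⟨i, h₁, h₂⟩ := wellFounded_lt.has_min {i | x i ≠ y i} (Function.ne_iff.1 h)
  exact ⟨i, fun i' hi' => by_contra fun h => h₂ i' h hi', h₁⟩

theorem vertexKey_ne {x y : Fin 15 → Fin m} (h : x ≠ y) (j k : Fin 4) :
    vertexKey x j ≠ vertexKey y k := by
  intro hjk
  obtain ⟨i, hxy, hi⟩ := exists_first_ne h
  have h := vertexKey_lt_iff (fun i' hi' => (hxy i' hi').symm) hi.symm k j
  rw [vertexCmp_swap i hi, hjk] at h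
  have h' := vertexKey_lt_iff hxy hi j k
  rw [hjk] at h'
  exact lt_irrefl _ (h.2 (by simpa using h'.not.1 (lt_irrefl _)))

/-- A family of edges in which any two have the same relative position is determined by a single
coordinate. -/
theorem IsHomogeneous.card_le_of_vertexKey {A : Finset (Fin 15 → Fin m)} (hm : 1 ≤ m)
    (hA : IsHomogeneous vertexKey A) : #A ≤ m := by
  obtain ⟨D, hD⟩ := hA
  by_cases h : ∃ i p, ∀ j k, D j k ↔ vertexCmp i p j k
  · obtain ⟨i₀, p₀, h₀⟩ := h
    have hinj : Set.InjOn (fun x : Fin 15 → Fin m => x i₀) A := by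
      intro x hx y hy hxy
      by_contra hne
      obtain ⟨i, hlt, hi⟩ := exists_first_ne hne
      have hii : i = i₀ := by
        rcases hD x hx y hy hne with h | h
        · exact eq_of_vertexCmp_eq _ _ _ _ fun j k => Bool.eq_iff_iff.2 <|
            (vertexKey_lt_iff hlt hi j k).symm.trans ((h j k).trans (h₀ j k))
        · exact eq_of_vertexCmp_eq _ _ _ _ fun j k => Bool.eq_iff_iff.2 <|
            (vertexKey_lt_iff (fun i' hi' => (hlt i' hi').symm) hi.symm j k).symm.trans
            ((h j k).trans (h₀ j k))
      exact hi (hii ▸ hxy)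
    simpa using card_le_card_of_injOn (t := univ) _ (by simp) hinj
  · refine (card_le_one.2 fun x hx y hy => ?_).trans hm
    by_contra hne
    obtain ⟨i, hlt, hi⟩ := exists_first_ne hne
    rcases hD x hx y hy hne with h' | h'
    · exact h ⟨i, _, fun j k => (h' j k).symm.trans (vertexKey_lt_iff hlt hi j k)⟩
    · exact h ⟨i, _, fun j k => (h' j k).symm.trans
        (vertexKey_lt_iff (fun i' hi' => (hlt i' hi').symm) hi.symm j k)⟩

theorem exists_isOrderedMatching_Lmax_le {n : ℕ} (hm : 1 ≤ m) (hn : n ≤ m ^ 15) :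
    ∃ M, IsOrderedMatching 4 n M ∧ Lmax 4 M ≤ m := by
  obtain ⟨X, -, rfl⟩ := exists_subset_card_eq (s := (univ : Finset (Fin 15 → Fin m))) (n := n)
    (by simpa using hn)
  exact exists_isOrderedMatching_of_isHomogeneous (by norm_num) vertexKey_strictMono
    (fun _ _ h => vertexKey_ne h) fun A _ hA => hA.card_le_of_vertexKey hm

end UpperBound

end OrderedMatching

/-- **Theorem 1.2, case r = 4.** For every positive integer `n`, the Ramsey
parameter `L_4(n)` (the minimum of `L(M)` over ordered `4`-matchings `M` of
size `n`) satisfies `(1/4)·n^(1/15) ≤ L_4(n) ≤ ⌈n^(1/15)⌉`: every ordered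
`4`-matching of size `n` has `L(M) ≥ (1/4)·n^(1/15)`, and some ordered
`4`-matching of size `n` has `L(M) ≤ ⌈n^(1/15)⌉`. -/
theorem ramsey_four (n : ℕ) (hn : 1 ≤ n) :
    (∀ M : Finset (Finset ℕ), IsOrderedMatching 4 n M →
      (1 / 4 : ℝ) * (n : ℝ) ^ ((1 : ℝ) / 15) ≤ (Lmax 4 M : ℝ)) ∧
    (∃ M : Finset (Finset ℕ), IsOrderedMatching 4 n M ∧
      Lmax 4 M ≤ ⌈(n : ℝ) ^ ((1 : ℝ) / 15)⌉₊) := by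
  refine ⟨fun M hM => ?_, ?_⟩
  · have h := card_le_Lmax_pow (r := 3) hM
    have h₁ : (n : ℝ) ≤ (4 * Lmax 4 M : ℝ) ^ 15 := by
      have h₂ : (n : ℝ) ≤ 13824 * (Lmax 4 M : ℝ) ^ 15 := by exact_mod_cast h
      have h₃ : (0 : ℝ) ≤ (Lmax 4 M : ℝ) ^ 15 := by positivity
      rw [mul_pow]
      linarith
    have h₂ : (n : ℝ) ^ ((1 : ℝ) / 15) ≤ 4 * Lmax 4 M := by
      refine (Real.rpow_le_rpow (by positivity) h₁ (by norm_num)).trans_eq ?_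
      rw [← Real.rpow_natCast, ← Real.rpow_mul (by positivity)]
      norm_num
    linarith
  · refine exists_isOrderedMatching_Lmax_le (Nat.one_le_ceil_iff.2 (by positivity)) ?_
    have h : ((n : ℝ) ^ ((1 : ℝ) / 15)) ^ 15 = n := by
      rw [← Real.rpow_natCast, ← Real.rpow_mul (by positivity)]
      norm_num
    have h₁ := pow_le_pow_left₀ (by positivity) (Nat.le_ceil ((n : ℝ) ^ ((1 : ℝ) / 15))) 15
    rw [h] at h₁
    exact_mod_cast h₁
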